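/- arXiv:2604.08969 — 2 statements merged into one kernel-verified Lean document; each statement's English description precedes it below -/
import Mathlib

section
/- Let u ∈ ℝ^J with ‖u‖₁ > R for some R > 0. Then there exists a unique λ > 0 such that ∑_{i=1}^J max(|u_i| − λ, 0) = R, and the vector v with coordinates v_i = sgn(u_i)·max(|u_i| − λ, 0) is the unique minimizer of ‖u − w‖₂ over the ℓ¹-ball {w ∈ ℝ^J : ‖w‖₁ ≤ R}; moreover ‖v‖₁ = R. -/
theorem abs_sign_mul_max_sub {l : ℝ} (hl : 0 ≤ l) (a : ℝ) :
    |Real.sign a * max (|a| - l) 0| = max (|a| - l) 0 := by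
  have hm : 0 ≤ max (|a| - l) 0 := le_max_right _ _
  rcases lt_trichotomy a 0 with h | rfl | h
  · rw [Real.sign_of_neg h, neg_one_mul, abs_neg, abs_of_nonneg hm]
  · simp [hl]
  · rw [Real.sign_of_pos h, one_mul, abs_of_nonneg hm]

/-- Strong-convexity inequality for scalar soft thresholding. -/
theorem sq_sub_soft_threshold_add_le {l : ℝ} (hl : 0 ≤ l) (a w : ℝ) :
    (a - Real.sign a * max (|a| - l) 0) ^ 2 + (Real.sign a * max (|a| - l) 0 - w) ^ 2
      + 2 * l * (max (|a| - l) 0 - |w|) ≤ (a - w) ^ 2 := by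
  rcases le_total (|a|) l with h | h
  · rw [max_eq_right (by linarith)]
    have : a * w ≤ l * |w| := calc
      a * w ≤ |a * w| := le_abs_self _
      _ = |a| * |w| := abs_mul _ _
      _ ≤ l * |w| := by gcongr
    nlinarith
  · rw [max_eq_left (by linarith)]
    have h₁ := mul_le_mul_of_nonneg_left (le_abs_self w) hl
    have h₂ := mul_le_mul_of_nonneg_left (neg_le_abs w) hl
    rcases lt_trichotomy a 0 with ha | rfl | ha
    · rw [Real.sign_of_neg ha, abs_of_neg ha]
      nlinarith
    · obtain rfl : l = 0 := le_antisymm (by simpa using h) hl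
      simp
    · rw [Real.sign_of_pos ha, abs_of_pos ha]
      nlinarith

theorem exists_pos_sum_max_abs_sub_eq {ι : Type*} [Fintype ι] {R : ℝ} (hR : 0 < R) {u : ι → ℝ}
    (hu : R < ∑ i, |u i|) : ∃ l : ℝ, 0 < l ∧ ∑ i, max (|u i| - l) 0 = R := by
  have hcont : Continuous fun l : ℝ => ∑ i, max (|u i| - l) 0 := by fun_prop
  have h₀ : ∑ i, max (|u i| - 0) 0 = ∑ i, |u i| := by simp
  have h₁ : ∑ i, max (|u i| - ∑ j, |u j|) 0 = 0 :=
    Finset.sum_eq_zero fun i hi => max_eq_right <| sub_nonpos.2 <|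
      Finset.single_le_sum (f := fun j => |u j|) (fun j _ => abs_nonneg _) hi
  obtain ⟨l, hl, hlR⟩ := intermediate_value_Icc' (Finset.sum_nonneg fun i _ => abs_nonneg (u i))
    hcont.continuousOn (show R ∈ Set.Icc _ _ from ⟨h₁.trans_le hR.le, hu.le.trans_eq h₀.symm⟩)
  refine ⟨l, lt_of_le_of_ne hl.1 ?_, hlR⟩
  rintro rfl
  exact hu.ne (hlR.symm.trans h₀)

theorem sum_max_sub_lt_sum_max_sub {ι : Type*} [Fintype ι] {a : ι → ℝ} {l l' : ℝ} (h : l < l')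
    (hpos : 0 < ∑ i, max (a i - l') 0) :
    ∑ i, max (a i - l') 0 < ∑ i, max (a i - l) 0 := by
  obtain ⟨i, hi, hi'⟩ :=
    Finset.exists_lt_of_sum_lt (f := fun _ : ι => (0 : ℝ)) (by simpa using hpos)
  refine Finset.sum_lt_sum (fun j _ => max_le_max_right _ (by linarith)) ⟨i, hi, ?_⟩
  have hi₀ : 0 < a i - l' := by simpa using hi'
  rw [max_eq_left hi₀.le]
  exact lt_max_of_lt_left (by linarith)

/-- For `u ∈ ℝ^J` with `‖u‖₁ > R > 0` there is a unique `λ > 0` with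
`∑ᵢ max(|uᵢ| − λ, 0) = R`, and the soft-thresholded vector
`vᵢ = sgn(uᵢ)·max(|uᵢ| − λ, 0)` is the unique minimizer of `‖u − w‖₂` over the
`ℓ¹`-ball `{w : ‖w‖₁ ≤ R}`; moreover `‖v‖₁ = R`.  (Uniqueness of the minimizer is
expressed by the strict inequality for every other point of the ball.) -/
theorem stmt10 (J : ℕ) (R : ℝ) (hR : 0 < R) (u : Fin J → ℝ)
    (hu : R < ∑ i, |u i|) :
    ∃ l : ℝ, 0 < l ∧ (∑ i, max (|u i| - l) 0) = R ∧
      (∀ l' : ℝ, 0 < l' → (∑ i, max (|u i| - l') 0) = R → l' = l) ∧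
      (∑ i, |Real.sign (u i) * max (|u i| - l) 0|) = R ∧
      (∀ w : Fin J → ℝ, (∑ i, |w i|) ≤ R →
        Real.sqrt (∑ i, (u i - Real.sign (u i) * max (|u i| - l) 0) ^ 2)
          ≤ Real.sqrt (∑ i, (u i - w i) ^ 2)) ∧
      (∀ w : Fin J → ℝ, (∑ i, |w i|) ≤ R →
        w ≠ (fun i => Real.sign (u i) * max (|u i| - l) 0) →
        Real.sqrt (∑ i, (u i - Real.sign (u i) * max (|u i| - l) 0) ^ 2)
          < Real.sqrt (∑ i, (u i - w i) ^ 2)) := by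
  obtain ⟨l, hl, hlR⟩ := exists_pos_sum_max_abs_sub_eq hR hu
  have key (w : Fin J → ℝ) (hw : ∑ i, |w i| ≤ R) :
      ∑ i, (u i - Real.sign (u i) * max (|u i| - l) 0) ^ 2
        + ∑ i, (Real.sign (u i) * max (|u i| - l) 0 - w i) ^ 2 ≤ ∑ i, (u i - w i) ^ 2 := by
    have h := Finset.sum_le_sum fun i (_ : i ∈ Finset.univ) =>
      sq_sub_soft_threshold_add_le hl.le (u i) (w i)
    rw [Finset.sum_add_distrib, Finset.sum_add_distrib, ← Finset.mul_sum, Finset.sum_sub_distrib,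
      hlR] at h
    have : 0 ≤ 2 * l * (R - ∑ i, |w i|) := mul_nonneg (by linarith) (by linarith)
    linarith
  refine ⟨l, hl, hlR, fun l' _ hl'R => ?_, ?_, fun w hw => ?_, fun w hw hne => ?_⟩
  · rcases lt_trichotomy l' l with h | h | h
    · have := sum_max_sub_lt_sum_max_sub h (hlR ▸ hR)
      linarith
    · exact h
    · have := sum_max_sub_lt_sum_max_sub h (hl'R ▸ hR)
      linarith
  · simp_rw [abs_sign_mul_max_sub hl.le]
    exact hlR
  · refine Real.sqrt_le_sqrt ((le_add_of_nonneg_right ?_).trans (key w hw))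
    exact Finset.sum_nonneg fun i _ => sq_nonneg _
  · refine Real.sqrt_lt_sqrt (Finset.sum_nonneg fun i _ => sq_nonneg _)
      ((lt_add_of_pos_right _ ?_).trans_le (key w hw))
    obtain ⟨i, hi⟩ := Function.ne_iff.1 hne
    exact Finset.sum_pos' (fun i _ => sq_nonneg _)
      ⟨i, Finset.mem_univ i, sq_pos_of_ne_zero (sub_ne_zero.2 hi.symm)⟩
end

section
/- Fix s > 0 and positive constants w₁, w₃, w₄, A with A·w₁ ≥ 1. Let (e_t)_{t≥0} be nonnegative reals, set γ_t = A/t and J_t = ⌈t^{1/(2s+1)}⌉, and suppose there exists an integer t₀ ≥ 2 such that for all t ≥ t₀, e_t ≤ (1 − w₁ γ_t) e_{t−1} + γ_t · w₃ / J_t^{2s} + w₄ · J_t · γ_t², with 1 − w₁γ_t ≥ 0 for t ≥ t₀. Then there exists a constant C > 0 such that e_t ≤ C · t^{−2s/(2s+1)} for all t ≥ t₀. -/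
/-- Bernoulli's inequality in the form `(x - 1) ^ a ≤ x ^ a * (1 - a / x)`. -/
lemma sub_one_rpow_le {x a : ℝ} (hx : 1 ≤ x) (ha₀ : 0 ≤ a) (ha₁ : a ≤ 1) :
    (x - 1) ^ a ≤ x ^ a * (1 - a / x) := by
  have hx₀ : 0 < x := by linarith
  have hinv : 1 / x ≤ 1 := by rw [div_le_one hx₀]; exact hx
  have hb := rpow_one_add_le_one_add_mul_self (s := -(1 / x)) (by linarith) ha₀ ha₁
  calc (x - 1) ^ a = (x * (1 + -(1 / x))) ^ a := by
        congr 1; field_simp; ring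
    _ = x ^ a * (1 + -(1 / x)) ^ a := Real.mul_rpow hx₀.le (by linarith)
    _ ≤ x ^ a * (1 + a * -(1 / x)) := by gcongr
    _ = x ^ a * (1 - a / x) := by ring

/-- A Chung-type lemma: if `t * f t` grows by at most `K * t ^ (a - 1)` at each step, then
`t * f t` is at most of order `t ^ a`. -/
lemma mul_le_mul_rpow_of_recursion {a K : ℝ} (ha₀ : 0 < a) (ha₁ : a ≤ 1) (hK : 0 ≤ K)
    {f : ℕ → ℝ} {n₀ : ℕ} (hn₀ : 1 ≤ n₀) (hf₀ : 0 ≤ f n₀)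
    (hf : ∀ t, n₀ < t → t * f t ≤ ((t : ℝ) - 1) * f (t - 1) + K * (t : ℝ) ^ a / t) :
    ∀ t, n₀ ≤ t → t * f t ≤ (n₀ * f n₀ + K / a) * (t : ℝ) ^ a := by
  have hC : 0 ≤ n₀ * f n₀ + K / a := by positivity
  intro t ht
  induction t, ht using Nat.le_induction with
  | base =>
    have h1 : 1 ≤ (n₀ : ℝ) ^ a := Real.one_le_rpow (by exact_mod_cast hn₀) ha₀.le
    have h2 : 0 ≤ K / a := by positivity
    nlinarith
  | succ n hn ih =>
    have hrec := hf (n + 1) (by omega)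
    have hb := sub_one_rpow_le (x := ((n + 1 : ℕ) : ℝ)) (by simp) ha₀.le ha₁
    have hcast : ((n + 1 : ℕ) : ℝ) - 1 = n := by push_cast; ring
    rw [hcast] at hrec hb
    rw [Nat.add_sub_cancel] at hrec
    have hpos : 0 < ((n + 1 : ℕ) : ℝ) := by positivity
    generalize ((n + 1 : ℕ) : ℝ) = x at *
    have hKC : K ≤ (n₀ * f n₀ + K / a) * a := by
      have : (n₀ * f n₀ + K / a) * a = n₀ * f n₀ * a + K := by field_simp
      rw [this]
      have : 0 ≤ n₀ * f n₀ * a := by positivity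
      linarith
    generalize n₀ * f n₀ + K / a = C at *
    calc x * f (n + 1) ≤ n * f n + K * x ^ a / x := hrec
      _ ≤ C * (x ^ a * (1 - a / x)) + C * a * x ^ a / x :=
        add_le_add (ih.trans (mul_le_mul_of_nonneg_left hb hC)) (by gcongr)
      _ = C * x ^ a := by ring

/-- The deterministic recursion behind Theorem 1 (streaming case):
with `γ_t = A/t`, `J_t = ⌈t^{1/(2s+1)}⌉`, `A·w₁ ≥ 1`, nonnegative `e_t` satisfying
`e_t ≤ (1 − w₁γ_t)e_{t−1} + γ_t w₃/J_t^{2s} + w₄ J_t γ_t²` for `t ≥ t₀` (with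
`1 − w₁γ_t ≥ 0` there), one has `e_t ≤ C·t^{−2s/(2s+1)}` for all `t ≥ t₀`, for some
constant `C > 0`. -/
theorem stmt13 (s w₁ w₃ w₄ A : ℝ)
    (hs : 0 < s) (hw₁ : 0 < w₁) (hw₃ : 0 < w₃) (hw₄ : 0 < w₄) (hA : 0 < A)
    (hAw₁ : 1 ≤ A * w₁)
    (γ : ℕ → ℝ) (hγ : ∀ t, γ t = A / t)
    (J : ℕ → ℕ) (hJ : ∀ t, J t = ⌈(t : ℝ) ^ (1 / (2 * s + 1))⌉₊)
    (e : ℕ → ℝ) (he : ∀ t, 0 ≤ e t)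
    (t₀ : ℕ) (ht₀ : 2 ≤ t₀)
    (hpos : ∀ t, t₀ ≤ t → 0 ≤ 1 - w₁ * γ t)
    (hrec : ∀ t, t₀ ≤ t →
      e t ≤ (1 - w₁ * γ t) * e (t - 1) + γ t * w₃ / (J t : ℝ) ^ (2 * s)
        + w₄ * (J t : ℝ) * (γ t) ^ 2) :
    ∃ C > 0, ∀ t, t₀ ≤ t → e t ≤ C * (t : ℝ) ^ (-(2 * s) / (2 * s + 1)) := by
  set a : ℝ := 1 / (2 * s + 1) with ha
  have ha₀ : 0 < a := by positivity
  have ha₁ : a ≤ 1 := by rw [ha, div_le_one (by linarith)]; linarith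
  have hexp : -(2 * s) / (2 * s + 1) = a - 1 := by rw [ha]; field_simp; ring
  have hsa : a * (2 * s) = 1 - a := by rw [ha]; field_simp; ring
  set K : ℝ := A * w₃ + 2 * w₄ * A ^ 2 with hK
  have hK₀ : 0 < K := by positivity
  have hstep : ∀ t : ℕ, t₀ < t →
      t * e t ≤ ((t : ℝ) - 1) * e (t - 1) + K * (t : ℝ) ^ a / t := by
    intro t ht
    have hx : 1 ≤ (t : ℝ) := by exact_mod_cast (by omega : 1 ≤ t)
    have hx₀ : 0 < (t : ℝ) := by linarith
    have hp : 1 ≤ (t : ℝ) ^ a := Real.one_le_rpow hx ha₀.le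
    have hJlow : (t : ℝ) ^ a ≤ J t := by rw [hJ]; exact Nat.le_ceil _
    have hJup : (J t : ℝ) ≤ 2 * (t : ℝ) ^ a := by
      rw [hJ]
      have := Nat.ceil_lt_add_one (a := (t : ℝ) ^ a) (by linarith)
      linarith
    have hJpow : t / (t : ℝ) ^ a ≤ (J t : ℝ) ^ (2 * s) := by
      calc t / (t : ℝ) ^ a = ((t : ℝ) ^ a) ^ (2 * s) := by
            rw [← Real.rpow_mul hx₀.le, hsa, Real.rpow_sub hx₀, Real.rpow_one]
        _ ≤ _ := by gcongr
    have hrec' := hrec t ht.le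
    rw [hγ] at hrec'
    generalize (t : ℝ) ^ a = p at *
    generalize (t : ℝ) = x at *
    have hp₀ : 0 < p := by linarith
    have hcontr : 1 - w₁ * (A / x) ≤ 1 - 1 / x := by
      have : 1 / x ≤ A * w₁ / x := by gcongr
      have h2 : w₁ * (A / x) = A * w₁ / x := by ring
      linarith
    calc x * e t ≤ x * ((1 - 1 / x) * e (t - 1) + A / x * w₃ / (x / p)
            + w₄ * (2 * p) * (A / x) ^ 2) := by
          gcongr
          refine hrec'.trans ?_
          gcongr
          exact he _
      _ = (x - 1) * e (t - 1) + K * p / x := by rw [hK]; field_simp; ring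
  refine ⟨t₀ * e t₀ + K / a, ?_, fun t ht => ?_⟩
  · have := he t₀
    positivity
  · have hx₀ : 0 < (t : ℝ) := by exact_mod_cast (by omega : 0 < t)
    have h := mul_le_mul_rpow_of_recursion ha₀ ha₁ hK₀.le (by omega) (he t₀) hstep t ht
    rw [hexp, Real.rpow_sub_one hx₀.ne', ← mul_div_assoc, le_div_iff₀ hx₀]
    linarith
end
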